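/- Assume k is algebraically closed. Then M_4 = in_≼(Q_4), i.e. the monomial ideal M_4 is exactly the initial ideal of the ideal Q_4 with respect to the given reverse lexicographic order; in particular Q_4 has a Gröbner basis consisting of the five listed quadrics. -/

import Mathlib

open MvPolynomial

/- The polynomial ring `R = k[e₁,e₂,e₃,e₄,f₁₂,f₁₃,f₁₄,f₂₃,f₂₄,f₃₄]` is modelled as
`MvPolynomial (Fin 10) k`, with `e₁ = X 0, e₂ = X 1, e₃ = X 2, e₄ = X 3`,
`f₁₂ = X 4, f₁₃ = X 5, f₁₄ = X 6, f₂₃ = X 7, f₂₄ = X 8, f₃₄ = X 9`.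
The grading group is `ℤ⁵` with basis `ℓ, ε₁, ε₂, ε₃, ε₄` (coordinate 0 is the
`ℓ`-coordinate); `deg eᵢ = εᵢ`, `deg fᵢⱼ = ℓ − εᵢ − εⱼ`. -/
def deg4 : Fin 10 → Fin 5 → ℤ :=
  ![![0,1,0,0,0], ![0,0,1,0,0], ![0,0,0,1,0], ![0,0,0,0,1],
    ![1,-1,-1,0,0], ![1,-1,0,-1,0], ![1,-1,0,0,-1],
    ![1,0,-1,-1,0], ![1,0,-1,0,-1], ![1,0,0,-1,-1]]

/-- The ideal `Q₄` generated by the five quadric relations among the distinguished sections of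
the conic bundles on the degree-5 Del Pezzo surface. -/
noncomputable def Q4 (k : Type*) [Field k] : Ideal (MvPolynomial (Fin 10) k) :=
  Ideal.span
    {X 6 * X 7 - X 4 * X 9 - X 5 * X 8,
     X 1 * X 4 - X 2 * X 5 - X 3 * X 6,
     X 0 * X 4 - X 2 * X 7 - X 3 * X 8,
     X 0 * X 5 - X 1 * X 7 + X 3 * X 9,
     X 0 * X 6 - X 1 * X 8 - X 2 * X 9}

/-- The monomial ideal `M₄ = (f₂₃f₁₄, e₁f₁₄, e₁f₁₃, e₂f₁₂, e₁f₁₂)`. -/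
noncomputable def M4 (k : Type*) [Field k] : Ideal (MvPolynomial (Fin 10) k) :=
  Ideal.span {X 7 * X 6, X 0 * X 6, X 0 * X 5, X 1 * X 4, X 0 * X 4}

/-- The `P`-degree of a monomial for the grading `deg`. -/
def mdeg {n : ℕ} {P : Type*} [AddCommMonoid P] (deg : Fin n → P) (a : Fin n →₀ ℕ) : P :=
  a.sum fun i e => e • deg i

/-- The `k`-span of the monomials of degree `D`. -/
noncomputable def degSub {k : Type*} [Field k] {n : ℕ} {P : Type*} [AddCommMonoid P]
    (deg : Fin n → P) (D : P) : Submodule k (MvPolynomial (Fin n) k) :=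
  Submodule.span k
    ((fun a => (monomial a (1 : k) : MvPolynomial (Fin n) k)) '' { a | mdeg deg a = D })

/-- The degree-`D` piece `(R/Q)_D` of the quotient. -/
noncomputable def quotPiece {k : Type*} [Field k] {n : ℕ} {P : Type*} [AddCommMonoid P]
    (Q : Ideal (MvPolynomial (Fin n) k)) (deg : Fin n → P) (D : P) :
    Submodule k (MvPolynomial (Fin n) k ⧸ Submodule.restrictScalars k Q) :=
  Submodule.map (Submodule.restrictScalars k Q).mkQ (degSub deg D)

/-- Total degree of an exponent vector. -/
def tdeg {n : ℕ} (a : Fin n →₀ ℕ) : ℕ := a.sum fun _ e => e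

/-- The chain of variables in decreasing order for the reverse lexicographic order
`e₁ ≻ e₂ ≻ e₃ ≻ e₄ ≻ f₁₂ ≻ f₁₃ ≻ f₂₃ ≻ f₁₄ ≻ f₂₄ ≻ f₃₄`: `chain j` is the (index of the)
`j`-th largest variable. -/
def chain4 : Fin 10 → Fin 10 := ![0, 1, 2, 3, 4, 5, 7, 6, 8, 9]

/-- The (graded) reverse lexicographic order with `e₁ ≻ e₂ ≻ e₃ ≻ e₄ ≻ f₁₂ ≻ f₁₃ ≻ f₂₃ ≻ f₁₄ ≻
f₂₄ ≻ f₃₄`: `a ≺ b` iff `a` has smaller total degree, or the total degrees agree and the last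
variable (in the chain) where the exponents differ has larger exponent in `a`. -/
def revlex4 (a b : Fin 10 →₀ ℕ) : Prop :=
  a = b ∨ tdeg a < tdeg b ∨
    (tdeg a = tdeg b ∧ ∃ j : Fin 10, b (chain4 j) < a (chain4 j) ∧
      ∀ j' : Fin 10, j < j' → a (chain4 j') = b (chain4 j'))

/-- The initial ideal of `I` w.r.t. the order `le`: the ideal generated by the leading
monomials of the nonzero elements of `I`. -/
noncomputable def initIdeal {k : Type*} [Field k] {n : ℕ}
    (le : (Fin n →₀ ℕ) → (Fin n →₀ ℕ) → Prop) (I : Ideal (MvPolynomial (Fin n) k)) :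
    Ideal (MvPolynomial (Fin n) k) :=
  Ideal.span { m | ∃ f ∈ I, f ≠ 0 ∧ ∃ a ∈ f.support,
    (∀ b ∈ f.support, le b a) ∧ m = monomial a (1 : k) }

/-- The pairs `(i, j)` for which `X i * X j` is one of the five generators of `M4`. -/
def initPairs : Finset (Fin 10 × Fin 10) := {(7, 6), (0, 6), (0, 5), (1, 4), (0, 4)}

/-- The exponent vector of `X p.1 * X p.2`. -/
noncomputable def pairExp (p : Fin 10 × Fin 10) : Fin 10 →₀ ℕ :=
  Finsupp.single p.1 1 + Finsupp.single p.2 1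

/-- An exponent vector is standard if its monomial is divisible by no generator of `M4`. -/
def IsStandard (a : Fin 10 →₀ ℕ) : Prop := ∀ p ∈ initPairs, a p.1 = 0 ∨ a p.2 = 0

/-- The partial sums of the exponents along `chain4`, starting with the longest: comparing these
vectors lexicographically is comparing exponents for `revlex4`. -/
def partialSums (a : Fin 10 →₀ ℕ) : Lex (Fin 10 → ℕ) :=
  toLex fun n => ∑ j ∈ Finset.Iic n.rev, a (chain4 j)

lemma partialSums_add (a b : Fin 10 →₀ ℕ) :
    partialSums (a + b) = partialSums a + partialSums b := by
  unfold partialSums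
  rw [← toLex_add]
  congr 1
  funext n
  simp [Finset.sum_add_distrib]

lemma tdeg_eq_sum (a : Fin 10 →₀ ℕ) : tdeg a = ∑ j, a (chain4 j) := by
  rw [tdeg, Finsupp.sum_fintype _ _ fun _ => rfl]
  simp only [Fin.sum_univ_succ]
  simp [chain4]
  ring

lemma partialSums_lt_of_revlex4 {a b : Fin 10 →₀ ℕ} (h : revlex4 a b) (hne : a ≠ b) :
    partialSums a < partialSums b := by
  rw [revlex4, tdeg_eq_sum, tdeg_eq_sum] at h
  rcases h with h | h | ⟨h, j, hj, hgt⟩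
  · exact absurd h hne
  · refine ⟨0, fun i hi => absurd hi (Fin.not_lt_zero i), ?_⟩
    have : Finset.Iic (Fin.rev (0 : Fin 10)) = Finset.univ := by decide
    change ∑ j ∈ Finset.Iic (Fin.rev 0), a (chain4 j) < ∑ j ∈ Finset.Iic (Fin.rev 0), b (chain4 j)
    rwa [this]
  · have split (c : Fin 10 →₀ ℕ) (r : Fin 10) : ∑ i, c (chain4 i) =
        ∑ i ∈ Finset.Iic r, c (chain4 i) + ∑ i ∈ Finset.Ioi r, c (chain4 i) := by
      rw [← Finset.sum_union (Finset.disjoint_left.2 fun x hx hx' => by simp at hx hx'; omega)]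
      congr 1
      ext x
      simp [le_or_gt]
    have tail (r : Fin 10) (hr : j ≤ r) :
        ∑ i ∈ Finset.Ioi r, a (chain4 i) = ∑ i ∈ Finset.Ioi r, b (chain4 i) :=
      Finset.sum_congr rfl fun i hi => hgt i (hr.trans_lt (Finset.mem_Ioi.1 hi))
    have head (c : Fin 10 →₀ ℕ) : ∑ i ∈ Finset.Iic j, c (chain4 i) =
        c (chain4 j) + ∑ i ∈ Finset.Iio j, c (chain4 i) := by
      rw [← Finset.Iio_insert, Finset.sum_insert (by simp)]
    have hIic : ∑ i ∈ Finset.Iio j, a (chain4 i) < ∑ i ∈ Finset.Iio j, b (chain4 i) := by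
      have := split a j
      have := split b j
      have := tail j le_rfl
      have := head a
      have := head b
      omega
    have hj0 : 0 < j.val := by
      by_contra h0
      have : Finset.Iio j = ∅ := by ext x; simp; omega
      simp [this] at hIic
    obtain ⟨n, hn⟩ : ∃ n : Fin 10, n.val = 10 - j := ⟨⟨10 - j, by omega⟩, rfl⟩
    refine ⟨n, fun i hi => ?_, ?_⟩
    · have hi : i.val < n.val := hi
      have := split a i.rev
      have := split b i.rev
      have := tail i.rev (by rw [Fin.le_def, Fin.val_rev]; omega)
      change ∑ j ∈ Finset.Iic i.rev, a (chain4 j) = ∑ j ∈ Finset.Iic i.rev, b (chain4 j)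
      omega
    · have : Finset.Iic n.rev = Finset.Iio j := by
        ext x
        rw [Finset.mem_Iic, Finset.mem_Iio, Fin.le_def, Fin.lt_def, Fin.val_rev]
        omega
      change ∑ i ∈ Finset.Iic n.rev, a (chain4 i) < ∑ i ∈ Finset.Iic n.rev, b (chain4 i)
      rwa [this]

section Relations

variable (k : Type*) [Field k]

/-- Each pair gives the leading monomial of one of the three-term generators of `Q4`. -/
lemma exists_relation {p : Fin 10 × Fin 10} (hp : p ∈ initPairs) :
    ∃ (u v : Fin 10 →₀ ℕ) (s t : k),
      monomial (pairExp p) 1 + monomial u s + monomial v t ∈ Q4 k ∧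
        (revlex4 u (pairExp p) ∧ u ≠ pairExp p) ∧ revlex4 v (pairExp p) ∧ v ≠ pairExp p := by
  have key (p q r : Fin 10 × Fin 10) (s t : k)
      (hQ : X p.1 * X p.2 + C s * (X q.1 * X q.2) + C t * (X r.1 * X r.2) ∈ Q4 k)
      (j j' : Fin 10)
      (hq : pairExp p (chain4 j) < pairExp q (chain4 j) ∧
        ∀ i, j < i → pairExp q (chain4 i) = pairExp p (chain4 i))
      (hr : pairExp p (chain4 j') < pairExp r (chain4 j') ∧
        ∀ i, j' < i → pairExp r (chain4 i) = pairExp p (chain4 i)) :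
      ∃ (u v : Fin 10 →₀ ℕ) (s t : k),
        monomial (pairExp p) 1 + monomial u s + monomial v t ∈ Q4 k ∧
          (revlex4 u (pairExp p) ∧ u ≠ pairExp p) ∧ revlex4 v (pairExp p) ∧ v ≠ pairExp p := by
    have hdeg (q : Fin 10 × Fin 10) : tdeg (pairExp q) = 2 := by
      rw [tdeg, pairExp, Finsupp.sum_add_index'] <;> simp
    refine ⟨pairExp q, pairExp r, s, t, ?_, ⟨.inr (.inr ⟨by simp [hdeg], j, hq⟩), ?_⟩,
      .inr (.inr ⟨by simp [hdeg], j', hr⟩), ?_⟩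
    · convert hQ using 3 <;> simp [X, C_mul_monomial, monomial_mul, pairExp]
    · intro h
      simp [h] at hq
    · intro h
      simp [h] at hr
  have gen {f g : MvPolynomial (Fin 10) k} (hg : g ∈ ({
     X 6 * X 7 - X 4 * X 9 - X 5 * X 8,
     X 1 * X 4 - X 2 * X 5 - X 3 * X 6,
     X 0 * X 4 - X 2 * X 7 - X 3 * X 8,
     X 0 * X 5 - X 1 * X 7 + X 3 * X 9,
     X 0 * X 6 - X 1 * X 8 - X 2 * X 9} : Set (MvPolynomial (Fin 10) k))) (h : f = g) :
      f ∈ Q4 k := h ▸ Ideal.subset_span hg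
  simp only [initPairs, Finset.mem_insert, Finset.mem_singleton] at hp
  rcases hp with rfl | rfl | rfl | rfl | rfl
  · refine key _ (4, 9) (5, 8) (-1) (-1) (gen (.inl rfl) ?_) 9 8 ?_ ?_
    · simp; ring
    all_goals simp [pairExp, chain4, Finsupp.single_apply, Fin.forall_fin_succ]
  · refine key _ (1, 8) (2, 9) (-1) (-1) (gen (.inr (.inr (.inr (.inr rfl)))) ?_) 8 9 ?_ ?_
    · simp; ring
    all_goals simp [pairExp, chain4, Finsupp.single_apply, Fin.forall_fin_succ]
  · refine key _ (1, 7) (3, 9) (-1) 1 (gen (.inr (.inr (.inr (.inl rfl)))) ?_) 6 9 ?_ ?_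
    · simp; ring
    all_goals simp [pairExp, chain4, Finsupp.single_apply, Fin.forall_fin_succ]
  · refine key _ (2, 5) (3, 6) (-1) (-1) (gen (.inr (.inl rfl)) ?_) 5 7 ?_ ?_
    · simp; ring
    all_goals simp [pairExp, chain4, Finsupp.single_apply, Fin.forall_fin_succ]
  · refine key _ (2, 7) (3, 8) (-1) (-1) (gen (.inr (.inr (.inl rfl))) ?_) 6 8 ?_ ?_
    · simp; ring
    all_goals simp [pairExp, chain4, Finsupp.single_apply, Fin.forall_fin_succ]

lemma M4_eq_span : M4 k = Ideal.span ((fun p => monomial (pairExp p) 1) '' initPairs) := by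
  simp [M4, initPairs, Set.image_insert_eq, pairExp, X, monomial_mul]

end Relations

lemma exists_pairExp_add {a : Fin 10 →₀ ℕ} (ha : ¬ IsStandard a) :
    ∃ p ∈ initPairs, ∃ m, a = pairExp p + m := by
  simp only [IsStandard, not_forall, not_or] at ha
  obtain ⟨p, hp, h1, h2⟩ := ha
  have hne : p.1 ≠ p.2 := by
    revert p; simp [initPairs]
  refine ⟨p, hp, a - pairExp p, (add_tsub_cancel_of_le fun i => ?_).symm⟩
  simp only [pairExp, Finsupp.add_apply, Finsupp.single_apply]
  split_ifs with h h' h'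
  · exact absurd (h.trans h'.symm) hne
  · subst h; omega
  · subst h'; omega
  · omega

section Division

variable {k : Type*} [Field k]

lemma exists_standard_reduction (a : Fin 10 →₀ ℕ) (c : k) :
    ∃ h : MvPolynomial (Fin 10) k, monomial a c - h ∈ Q4 k ∧
      ∀ b ∈ h.support, IsStandard b ∧ partialSums b ≤ partialSums a := by
  induction hn : partialSums a using WellFoundedLT.induction generalizing a c with
  | ind n ih =>
  subst hn
  by_cases ha : IsStandard a
  · refine ⟨monomial a c, by simp, fun b hb => ?_⟩
    obtain rfl := Finset.mem_singleton.1 (support_monomial_subset hb)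
    exact ⟨ha, le_rfl⟩
  obtain ⟨p, hp, m, rfl⟩ := exists_pairExp_add ha
  obtain ⟨u, v, s, t, hQ, ⟨hu, hu'⟩, hv, hv'⟩ := exists_relation k hp
  have hlt {w : Fin 10 →₀ ℕ} (hw : revlex4 w (pairExp p)) (hw' : w ≠ pairExp p) :
      partialSums (w + m) < partialSums (pairExp p + m) := by
    rw [partialSums_add, partialSums_add]
    gcongr
    exact partialSums_lt_of_revlex4 hw hw'
  obtain ⟨g, hg, hg'⟩ := ih _ (hlt hu hu') (u + m) (-(c * s)) rfl
  obtain ⟨h, hh, hh'⟩ := ih _ (hlt hv hv') (v + m) (-(c * t)) rfl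
  refine ⟨g + h, ?_, fun b hb => ?_⟩
  · have := add_mem (add_mem ((Q4 k).mul_mem_left (monomial m c) hQ) hg) hh
    convert this using 1
    simp only [mul_add, monomial_mul, mul_one, add_comm m, map_neg]
    ring
  · classical
    rcases Finset.mem_union.1 (support_add hb) with hb | hb
    · exact ⟨(hg' b hb).1, (hg' b hb).2.trans (hlt hu hu').le⟩
    · exact ⟨(hh' b hb).1, (hh' b hb).2.trans (hlt hv hv').le⟩

end Division

section Pluecker

variable (k : Type*) [Field k]

/-- The `2 × 2` minor on columns `i, j` of the generic `2 × 5` matrix with rows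
`X 0, …, X 4` and `X 5, …, X 9`. -/
noncomputable def minor (i j : Fin 5) : MvPolynomial (Fin 10) k :=
  X (i.castAdd 5) * X (j.natAdd 5) - X (j.castAdd 5) * X (i.natAdd 5)

/-- The exponent vector of the diagonal term of `minor k i j`. -/
noncomputable def diagExp (i j : Fin 5) : Fin 10 →₀ ℕ :=
  Finsupp.single (i.castAdd 5) 1 + Finsupp.single (j.natAdd 5) 1

/-- The columns of the minor, up to sign the image of each variable in the Plücker algebra of
`Gr(2, 5)`. -/
def columns : Fin 10 → Fin 5 × Fin 5 :=
  ![(0, 4), (0, 3), (0, 2), (0, 1), (1, 2), (1, 3), (2, 3), (1, 4), (2, 4), (3, 4)]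

/-- The sign with which each variable is sent to a minor. -/
def signs : Fin 10 → k := ![1, 1, 1, 1, 1, 1, -1, 1, -1, 1]

/-- The map from the polynomial ring to the Plücker algebra of `Gr(2, 5)`. -/
noncomputable def toPluecker : MvPolynomial (Fin 10) k →ₐ[k] MvPolynomial (Fin 10) k :=
  aeval fun i => signs k i • minor k (columns i).1 (columns i).2

lemma Q4_le_ker : Q4 k ≤ RingHom.ker (toPluecker k) := by
  refine Ideal.span_le.2 ?_
  rintro f (rfl | rfl | rfl | rfl | rfl) <;>
  · simp [toPluecker, RingHom.mem_ker, signs, columns, minor]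
    ring

lemma degree_minor {i j : Fin 5} (hij : i < j) :
    MonomialOrder.lex.degree (minor k i j) = diagExp i j := by
  have hdeg (i j : Fin 5) : MonomialOrder.lex.degree
      (X (i.castAdd 5) * X (j.natAdd 5) : MvPolynomial (Fin 10) k) = diagExp i j := by
    rw [MonomialOrder.degree_mul (X_ne_zero _) (X_ne_zero _), MonomialOrder.degree_X,
      MonomialOrder.degree_X, diagExp]
  rw [minor, MonomialOrder.degree_sub_of_lt, hdeg]
  rw [hdeg, hdeg, MonomialOrder.lex_lt_iff]
  refine ⟨i.castAdd 5, fun l hl => ?_, ?_⟩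
  · have : l.val < i.val := hl
    simp [diagExp, Finsupp.single_apply, Fin.ext_iff]
    split_ifs <;> omega
  · have hij : i.val < j.val := hij
    simp only [diagExp, ofLex_toLex, Finsupp.add_apply, Finsupp.single_apply, Fin.ext_iff,
      Fin.val_castAdd, Fin.val_natAdd]
    split_ifs <;> omega

/-- The leading exponent of the image of a monomial under `toPluecker`. -/
noncomputable def plueckerExp (a : Fin 10 →₀ ℕ) : Fin 10 →₀ ℕ :=
  ∑ i, a i • diagExp (columns i).1 (columns i).2

variable {k}

lemma signs_smul_minor_ne_zero_and_degree (i : Fin 10) :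
    signs k i • minor k (columns i).1 (columns i).2 ≠ 0 ∧
    MonomialOrder.lex.degree (signs k i • minor k (columns i).1 (columns i).2) =
      diagExp (columns i).1 (columns i).2 := by
  have hcol : (columns i).1 < (columns i).2 := by revert i; decide
  have hd := degree_minor k hcol
  have hne : minor k (columns i).1 (columns i).2 ≠ 0 := by
    refine MonomialOrder.lex.ne_zero_of_degree_ne_zero fun h => ?_
    have := DFunLike.congr_fun (hd.symm.trans h) ((columns i).1.castAdd 5)
    simp [diagExp] at this
  have hs : signs k i = 1 ∨ signs k i = -1 := by
    fin_cases i <;> simp [signs]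
  rcases hs with hs | hs <;> simp [hs, hne, hd, MonomialOrder.degree_neg]

lemma toPluecker_monomial (a : Fin 10 →₀ ℕ) (c : k) : toPluecker k (monomial a c) =
    c • ∏ i, (signs k i • minor k (columns i).1 (columns i).2) ^ a i := by
  rw [toPluecker, aeval_monomial, Finsupp.prod_fintype _ _ fun _ => pow_zero _, Algebra.smul_def]

lemma toPluecker_monomial_ne_zero (a : Fin 10 →₀ ℕ) {c : k} (hc : c ≠ 0) :
    toPluecker k (monomial a c) ≠ 0 := by
  rw [toPluecker_monomial]
  exact smul_ne_zero hc (Finset.prod_ne_zero_iff.2 fun i _ =>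
    pow_ne_zero _ (signs_smul_minor_ne_zero_and_degree i).1)

lemma degree_toPluecker_monomial (a : Fin 10 →₀ ℕ) {c : k} (hc : c ≠ 0) :
    MonomialOrder.lex.degree (toPluecker k (monomial a c)) = plueckerExp a := by
  rw [toPluecker_monomial, MonomialOrder.degree_smul_of_isRegular (IsRegular.of_ne_zero hc),
    MonomialOrder.degree_prod fun i _ => pow_ne_zero _ (signs_smul_minor_ne_zero_and_degree i).1]
  simp only [MonomialOrder.degree_pow, (signs_smul_minor_ne_zero_and_degree _).2, plueckerExp]

lemma plueckerExp_apply (a : Fin 10 →₀ ℕ) :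
    plueckerExp a 0 = a 0 + a 1 + a 2 + a 3 ∧ plueckerExp a 1 = a 4 + a 5 + a 7 ∧
    plueckerExp a 2 = a 6 + a 8 ∧ plueckerExp a 3 = a 9 ∧ plueckerExp a 6 = a 3 ∧
    plueckerExp a 7 = a 2 + a 4 ∧ plueckerExp a 8 = a 1 + a 5 + a 6 ∧
    plueckerExp a 9 = a 0 + a 7 + a 8 + a 9 := by
  simp only [plueckerExp, diagExp, Fin.sum_univ_succ]
  simp [columns, Fin.ext_iff, add_assoc]

lemma IsStandard.apply_zero {a : Fin 10 →₀ ℕ} (ha : IsStandard a) : a 0 =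
    plueckerExp a 9 - plueckerExp a 3 - plueckerExp a 1 - plueckerExp a 2 := by
  obtain ⟨-, h1, h2, h3, -, -, -, h9⟩ := plueckerExp_apply a
  have h4 := ha (0, 4) (by decide)
  have h5 := ha (0, 5) (by decide)
  have h6 := ha (0, 6) (by decide)
  dsimp only at h4 h5 h6
  omega

lemma IsStandard.apply_one {a : Fin 10 →₀ ℕ} (ha : IsStandard a) : a 1 =
    plueckerExp a 0 - plueckerExp a 6 - a 0 - plueckerExp a 7 := by
  obtain ⟨h0, -, -, -, h6, h7, -, -⟩ := plueckerExp_apply a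
  have h4 := ha (1, 4) (by decide)
  dsimp only at h4
  omega

lemma IsStandard.apply_seven {a : Fin 10 →₀ ℕ} (ha : IsStandard a) : a 7 =
    plueckerExp a 9 - plueckerExp a 3 - a 0 - plueckerExp a 2 := by
  obtain ⟨-, -, h2, h3, -, -, -, h9⟩ := plueckerExp_apply a
  have h4 := ha (7, 6) (by decide)
  dsimp only at h4
  omega

lemma plueckerExp_injOn : Set.InjOn plueckerExp { a | IsStandard a } := by
  intro a ha b hb hab
  have h0 : a 0 = b 0 := by rw [ha.apply_zero, hb.apply_zero, hab]
  have h1 : a 1 = b 1 := by rw [ha.apply_one, hb.apply_one, hab, h0]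
  have h7 : a 7 = b 7 := by rw [ha.apply_seven, hb.apply_seven, hab, h0]
  have hA := plueckerExp_apply a
  have hB := plueckerExp_apply b
  rw [hab] at hA
  ext i
  fin_cases i <;> dsimp <;> omega

lemma eq_zero_of_mem_Q4_of_isStandard {f : MvPolynomial (Fin 10) k} (hf : f ∈ Q4 k)
    (hstd : ∀ a ∈ f.support, IsStandard a) : f = 0 := by
  by_contra hne
  obtain ⟨a, ha, hmax⟩ := f.support.exists_max_image
    (fun a => MonomialOrder.lex.toSyn (plueckerExp a)) (support_nonempty.2 hne)
  have hzero : toPluecker k f = 0 := Q4_le_ker k hf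
  rw [f.as_sum, map_sum] at hzero
  have hcoeff := congrArg (coeff (plueckerExp a)) hzero
  rw [coeff_sum, coeff_zero, Finset.sum_eq_single_of_mem a ha] at hcoeff
  · rw [← degree_toPluecker_monomial a (mem_support_iff.1 ha)] at hcoeff
    exact toPluecker_monomial_ne_zero a (mem_support_iff.1 ha)
      (MonomialOrder.lex.coeff_degree_eq_zero_iff.1 hcoeff)
  · intro b hb hba
    apply MonomialOrder.lex.coeff_eq_zero_of_lt
    rw [degree_toPluecker_monomial b (mem_support_iff.1 hb)]
    refine (hmax b hb).lt_of_ne fun h => hba ?_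
    exact plueckerExp_injOn (hstd b hb) (hstd a ha) (MonomialOrder.lex.toSyn.injective h)

end Pluecker

section InitialIdeal

variable {k : Type*} [Field k]

lemma not_isStandard_of_isMax {f : MvPolynomial (Fin 10) k} (hf : f ∈ Q4 k) {a : Fin 10 →₀ ℕ}
    (ha : a ∈ f.support) (hmax : ∀ b ∈ f.support, revlex4 b a) : ¬ IsStandard a := by
  classical
  intro hstd
  choose red hred hsupp using exists_standard_reduction (k := k)
  set g := monomial a (coeff a f) + ∑ b ∈ f.support.erase a, red b (coeff b f) with hg
  have hgQ : g ∈ Q4 k := by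
    have hfg : f - g = ∑ b ∈ f.support.erase a, (monomial b (coeff b f) - red b (coeff b f)) := by
      rw [Finset.sum_sub_distrib, hg]
      nth_rw 1 [f.as_sum]
      rw [← Finset.add_sum_erase _ _ ha]
      ring
    have : f - g ∈ Q4 k := hfg ▸ sum_mem fun b _ => hred b _
    simpa using sub_mem hf this
  have hcoeff : coeff a g = coeff a f := by
    rw [hg, coeff_add, coeff_monomial, if_pos rfl, coeff_sum, Finset.sum_eq_zero, add_zero]
    intro b hb
    by_contra h
    obtain ⟨hba, hb⟩ := Finset.mem_erase.1 hb
    exact ((hsupp b _ a (mem_support_iff.2 h)).2.trans_lt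
      (partialSums_lt_of_revlex4 (hmax b hb) hba)).false
  refine mem_support_iff.1 ha (hcoeff ▸ ?_)
  rw [eq_zero_of_mem_Q4_of_isStandard hgQ, coeff_zero]
  intro b hb
  rcases Finset.mem_union.1 (support_add hb) with hb | hb
  · obtain rfl := Finset.mem_singleton.1 (support_monomial_subset hb)
    exact hstd
  · obtain ⟨c, -, hc⟩ := Finset.mem_biUnion.1 (support_sum hb)
    exact (hsupp c _ b hc).1

end InitialIdeal

/-- Over an algebraically closed field, `M₄` is exactly the initial ideal of
`Q₄` with respect to the given reverse lexicographic order; in particular the five listed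
quadrics form a Gröbner basis of `Q₄`. -/
theorem stmt12 {k : Type*} [Field k] [IsAlgClosed k] :
    M4 k = initIdeal revlex4 (Q4 k) := by
  classical
  rw [M4_eq_span]
  refine le_antisymm (Ideal.span_le.2 ?_) (Ideal.span_le.2 ?_)
  · rintro _ ⟨p, hp, rfl⟩
    obtain ⟨u, v, s, t, hQ, ⟨hu, hu'⟩, hv, hv'⟩ := exists_relation k hp
    have ha : pairExp p ∈
        (monomial (pairExp p) 1 + monomial u s + monomial v t : MvPolynomial _ k).support := by
      simp [coeff_monomial, hu', hv']
    refine Ideal.subset_span ⟨_, hQ, support_nonempty.1 ⟨_, ha⟩, _, ha, fun b hb => ?_, rfl⟩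
    rcases Finset.mem_union.1 (support_add hb) with hb | hb
    · rcases Finset.mem_union.1 (support_add hb) with hb | hb <;>
        obtain rfl := Finset.mem_singleton.1 (support_monomial_subset hb)
      · exact .inl rfl
      · exact hu
    · obtain rfl := Finset.mem_singleton.1 (support_monomial_subset hb)
      exact hv
  · rintro _ ⟨f, hf, -, a, ha, hmax, rfl⟩
    obtain ⟨p, hp, m, rfl⟩ := exists_pairExp_add (not_isStandard_of_isMax hf ha hmax)
    have := Ideal.mul_mem_right (monomial m (1 : k)) _
      (Ideal.subset_span (Set.mem_image_of_mem (fun p => monomial (pairExp p) (1 : k)) hp))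
    simpa [monomial_mul] using this
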